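/- arXiv:2112.01443 — 4 statements merged into one kernel-verified Lean document; each statement's English description precedes it below -/
import Mathlib

section
/- For every positive integer g and every integer k ≥ 2, there exists a simple k-regular bipartite graph G such that G has girth at least g and the strong chromatic index of G satisfies χ'_s(G) ≥ 2k. -/
open SimpleGraph Finset

/-- Two edges `e`, `f` of `G` are strongly adjacent if they are distinct and either share an
endpoint, or each shares an endpoint with a common third edge of `G`. -/
def SimpleGraph.StrongAdj {V : Type*} (G : SimpleGraph V) (e f : Sym2 V) : Prop :=
  e ≠ f ∧ ((∃ v, v ∈ e ∧ v ∈ f) ∨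
    ∃ h ∈ G.edgeSet, (∃ v, v ∈ e ∧ v ∈ h) ∧ (∃ v, v ∈ h ∧ v ∈ f))

/-- `φ` is a strong edge-coloring of `G`: strongly adjacent edges get distinct colors. -/
def SimpleGraph.IsStrongEdgeColoring {V : Type*} (G : SimpleGraph V) (φ : Sym2 V → ℕ) : Prop :=
  ∀ e ∈ G.edgeSet, ∀ f ∈ G.edgeSet, G.StrongAdj e f → φ e ≠ φ f

/-- The strong chromatic index of `G`: the least `n` admitting a strong edge-coloring of `G`
using colors `0, …, n-1`. -/
noncomputable def SimpleGraph.strongChromaticIndex {V : Type*} (G : SimpleGraph V) : ℕ :=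
  sInf {n | ∃ φ : Sym2 V → ℕ, G.IsStrongEdgeColoring φ ∧ ∀ e ∈ G.edgeSet, φ e < n}

/-- `G` is `k`-regular: every vertex has exactly `k` neighbors. -/
def SimpleGraph.IsKRegular {V : Type*} (G : SimpleGraph V) (k : ℕ) : Prop :=
  ∀ v : V, (G.neighborSet v).ncard = k

/-- `N(e)`: the set of edges of `G` sharing at least one endpoint with `e`. -/
def SimpleGraph.edgeNbhd {V : Type*} (G : SimpleGraph V) (e : Sym2 V) : Set (Sym2 V) :=
  {f ∈ G.edgeSet | ∃ v, v ∈ e ∧ v ∈ f}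

namespace SimpleGraph

variable {V : Type*} {G : SimpleGraph V}

/-! ### Non-backtracking walks -/

/-- In a non-backtracking walk whose tail is a path, the first edge does not recur. -/
lemma Walk.IsPath.notMem_edges_of_isChain {u v w : V} {h : G.Adj u v} {p : G.Walk v w}
    (hp : p.IsPath) (hc : (Walk.cons h p).edges.IsChain (· ≠ ·)) : s(u, v) ∉ p.edges := by
  cases p with
  | nil => simp
  | cons h' q =>
    rw [Walk.cons_isPath_iff] at hp
    simp only [Walk.edges_cons, List.isChain_cons_cons] at hc
    rw [Walk.edges_cons, List.mem_cons, not_or]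
    exact ⟨hc.1, fun hq => hp.2 (q.snd_mem_support_of_mem_edges hq)⟩

/-- A non-backtracking walk that is not a path is at least as long as the girth. -/
lemma Walk.egirth_le_length_of_isChain {u v : V} (p : G.Walk u v)
    (hc : p.edges.IsChain (· ≠ ·)) (hp : ¬ p.IsPath) : G.egirth ≤ p.length := by
  classical
  induction p with
  | nil => simp at hp
  | @cons u v w h q ih =>
    have hq : q.edges.IsChain (· ≠ ·) := List.IsChain.of_cons hc
    by_cases hqp : q.IsPath
    · have hu : u ∈ q.support := by
        by_contra hu
        exact hp (hqp.cons hu)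
      have hcyc : (Walk.cons h (q.takeUntil u hu)).IsCycle :=
        (Walk.cons_isCycle_iff _ h).2 ⟨hqp.takeUntil hu, fun he =>
          hqp.notMem_edges_of_isChain hc (q.edges_takeUntil_subset_edges hu he)⟩
      refine (egirth_le_length hcyc).trans ?_
      simpa using q.length_takeUntil_le_length hu
    · refine (ih hq hqp).trans ?_
      simp

/-- A nontrivial closed non-backtracking walk that traverses each edge an even number of times is
longer than the girth. -/
lemma Walk.egirth_add_one_le_length_of_even_count [DecidableEq V] {u : V} (p : G.Walk u u)
    (hc : p.edges.IsChain (· ≠ ·)) (hp : ¬ p.Nil) (he : ∀ e, Even (p.edges.count e)) :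
    G.egirth + 1 ≤ p.length := by
  cases p with
  | nil => simp at hp
  | @cons _ v _ h q =>
    have hq : ¬ q.IsPath := fun hq => by
      have := he s(u, v)
      rw [Walk.edges_cons, List.count_cons_self,
        List.count_eq_zero_of_not_mem (hq.notMem_edges_of_isChain hc)] at this
      simp at this
    rw [Walk.length_cons, Nat.cast_add, Nat.cast_one]
    gcongr
    exact q.egirth_le_length_of_isChain (List.IsChain.of_cons hc) hq

/-! ### The parity cover of a graph -/

/-- The cover of `G` in which traversing an edge flips the coordinate of that edge. -/
def parityCover [DecidableEq V] (G : SimpleGraph V) : SimpleGraph (V × (Sym2 V → ZMod 2)) where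
  Adj x y := G.Adj x.1 y.1 ∧ y.2 = x.2 + Pi.single s(x.1, y.1) 1
  symm := ⟨fun x y h => ⟨h.1.symm, by
    rw [h.2, Sym2.eq_swap, add_assoc, ← Pi.single_add]
    simp [CharTwo.add_self_eq_zero]⟩⟩
  loopless := ⟨fun x h => h.1.ne rfl⟩

/-- The projection of the parity cover onto the base graph. -/
def parityCoverProj [DecidableEq V] (G : SimpleGraph V) : G.parityCover →g G where
  toFun := Prod.fst
  map_rel' h := h.1

section ParityCover

variable [DecidableEq V]

lemma parityCover_eq_of_adj {x y z : V × (Sym2 V → ZMod 2)} (hy : G.parityCover.Adj x y)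
    (hz : G.parityCover.Adj x z) (h : y.1 = z.1) : y = z :=
  Prod.ext h (by rw [hy.2, hz.2, h])

lemma IsKRegular.parityCover {k : ℕ} (hG : G.IsKRegular k) : G.parityCover.IsKRegular k := by
  intro x
  rw [← hG x.1]
  refine Set.ncard_congr (fun y _ => y.1) (fun y hy => hy.1)
    (fun y z hy hz h => parityCover_eq_of_adj hy hz h)
    (fun v hv => ⟨(v, x.2 + Pi.single s(x.1, v) 1), ⟨hv, rfl⟩, rfl⟩)

lemma isChain_edges_map_parityCoverProj {x y : V × (Sym2 V → ZMod 2)} (w : G.parityCover.Walk x y)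
    (hw : w.edges.IsChain (· ≠ ·)) : (w.map G.parityCoverProj).edges.IsChain (· ≠ ·) := by
  induction w with
  | nil => simp
  | @cons x y z h p ih =>
    cases p with
    | nil => simp
    | @cons _ t _ h' q =>
      simp only [Walk.edges_cons, List.isChain_cons_cons, Walk.map_cons] at hw ih ⊢
      refine ⟨fun heq => hw.1 ?_, ih hw.2⟩
      rw [Sym2.eq_swap, Sym2.congr_right] at heq
      rw [Sym2.eq_swap, parityCover_eq_of_adj h.symm h' heq]

lemma parityCover_snd_eq {x y : V × (Sym2 V → ZMod 2)} (w : G.parityCover.Walk x y)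
    (e : Sym2 V) : y.2 e = x.2 e + ((w.map G.parityCoverProj).edges.count e : ZMod 2) := by
  induction w with
  | nil => simp
  | @cons x y z h p ih =>
    rw [ih, h.2, Walk.map_cons, Walk.edges_cons, List.count_cons]
    change _ = _ + ((_ + if s(x.1, y.1) == e then 1 else 0 : ℕ) : ZMod 2)
    by_cases he : s(x.1, y.1) = e
    · subst he
      simp only [Pi.add_apply, Pi.single_eq_same, beq_self_eq_true, if_true]
      push_cast
      ring
    · simp [he]

lemma egirth_parityCover : G.egirth + 1 ≤ G.parityCover.egirth := by
  rw [le_egirth]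
  intro x w hw
  rw [← Walk.length_map G.parityCoverProj w]
  refine Walk.egirth_add_one_le_length_of_even_count _
    (isChain_edges_map_parityCoverProj w (List.Pairwise.isChain hw.edges_nodup)) ?_ fun e => ?_
  · rw [← Walk.length_eq_zero_iff, Walk.length_map, Walk.length_eq_zero_iff]
    exact hw.not_nil
  · rw [← ZMod.natCast_eq_zero_iff_even]
    simpa using parityCover_snd_eq w e

end ParityCover

/-- There are `k`-regular bipartite graphs of arbitrarily large girth on `2 ^ m * k` vertices. -/
lemma exists_isKRegular_bipartite_egirth (g k : ℕ) :
    ∃ (V : Type) (_ : Fintype V) (G : SimpleGraph V), G.IsKRegular k ∧ G.Colorable 2 ∧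
      (g : ℕ∞) ≤ G.egirth ∧ ∃ m, Fintype.card V = 2 ^ m * k := by
  classical
  induction g with
  | zero =>
    refine ⟨Fin k ⊕ Fin k, inferInstance, completeBipartiteGraph _ _, ?_,
      by simpa using (CompleteBipartiteGraph.bicoloring (Fin k) (Fin k)).colorable,
      by simp, 1, by simp [two_mul]⟩
    rintro (v | v)
    · have : (completeBipartiteGraph (Fin k) (Fin k)).neighborSet (Sum.inl v) =
          Set.range Sum.inr := by
        ext (x | x) <;> simp
      rw [this, Set.ncard_range_of_injective Sum.inr_injective, Nat.card_fin]
    · have : (completeBipartiteGraph (Fin k) (Fin k)).neighborSet (Sum.inr v) =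
          Set.range Sum.inl := by
        ext (x | x) <;> simp
      rw [this, Set.ncard_range_of_injective Sum.inl_injective, Nat.card_fin]
  | succ g ih =>
    obtain ⟨V, _, G, hreg, hcol, hg, m, hm⟩ := ih
    refine ⟨_, inferInstance, G.parityCover, hreg.parityCover,
      hcol.of_hom G.parityCoverProj, ?_, m + Fintype.card (Sym2 V), ?_⟩
    · refine le_trans ?_ egirth_parityCover
      push_cast
      gcongr
    · rw [Fintype.card_prod, hm, Fintype.card_fun, ZMod.card, pow_add]
      ring

/-! ### Strong edge-colorings of regular graphs -/

lemma exists_isStrongEdgeColoring_strongChromaticIndex [Finite V] (G : SimpleGraph V) :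
    ∃ φ : Sym2 V → ℕ, G.IsStrongEdgeColoring φ ∧
      ∀ e ∈ G.edgeSet, φ e < G.strongChromaticIndex := by
  refine Nat.sInf_mem (s := {n | ∃ φ : Sym2 V → ℕ, G.IsStrongEdgeColoring φ ∧
    ∀ e ∈ G.edgeSet, φ e < n}) ?_
  obtain ⟨n, ⟨f⟩⟩ := Finite.exists_equiv_fin (Sym2 V)
  exact ⟨n, fun e => f e, fun e _ e' _ h hf => h.1 (f.injective (Fin.ext hf)), fun e _ => (f e).2⟩

lemma IsStrongEdgeColoring.injOn_edgeNbhd {φ : Sym2 V → ℕ} (hφ : G.IsStrongEdgeColoring φ)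
    {e : Sym2 V} (he : e ∈ G.edgeSet) : Set.InjOn φ (G.edgeNbhd e) := by
  rintro a ⟨ha, v, hve, hva⟩ b ⟨hb, w, hwe, hwb⟩ hab
  by_contra hne
  exact hφ a ha b hb ⟨hne, Or.inr ⟨e, he, ⟨v, hva, hve⟩, ⟨w, hwe, hwb⟩⟩⟩ hab

lemma IsKRegular.degree_eq {k : ℕ} (hG : G.IsKRegular k) (v : V) [Fintype (G.neighborSet v)] :
    G.degree v = k := by
  rw [← hG v, ← card_neighborSet_eq_degree, ← Nat.card_eq_fintype_card, Nat.card_coe_set_eq]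

lemma IsKRegular.ncard_edgeNbhd [Fintype V] {k : ℕ} (hG : G.IsKRegular k) {e : Sym2 V}
    (he : e ∈ G.edgeSet) : (G.edgeNbhd e).ncard = 2 * k - 1 := by
  classical
  induction e with | _ u v
  have hN : G.edgeNbhd s(u, v) = ↑(G.incidenceFinset u ∪ G.incidenceFinset v) := by
    ext f
    simp [edgeNbhd, incidenceSet, and_or_left]
  have hI : G.incidenceFinset u ∩ G.incidenceFinset v = {s(u, v)} := by
    rw [← Finset.coe_inj]
    simpa using G.incidenceSet_inter_incidenceSet_of_adj he
  have hcard := Finset.card_union_add_card_inter (G.incidenceFinset u) (G.incidenceFinset v)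
  rw [hI, Finset.card_singleton, card_incidenceFinset_eq_degree, card_incidenceFinset_eq_degree,
    hG.degree_eq, hG.degree_eq] at hcard
  rw [hN, Set.ncard_coe_finset]
  omega

/-- If a `k`-regular graph has a strong edge-coloring with at most `2k - 1` colors, then `2k - 1`
divides its number of edges: the edge neighborhoods of a color class partition the edges. -/
lemma IsKRegular.dvd_card_edgeFinset [Fintype V] [Fintype G.edgeSet] {k : ℕ} (hk : 0 < k)
    (hG : G.IsKRegular k) (h : G.strongChromaticIndex ≤ 2 * k - 1) :
    2 * k - 1 ∣ #G.edgeFinset := by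
  classical
  obtain ⟨φ, hφ, hlt⟩ := G.exists_isStrongEdgeColoring_strongChromaticIndex
  have hex : ∀ e ∈ G.edgeSet, ∃! f, f ∈ G.edgeNbhd e ∧ φ f = 0 := by
    intro e he
    have himg : φ '' G.edgeNbhd e = ↑(Finset.range (2 * k - 1)) := by
      refine Set.eq_of_subset_of_ncard_le ?_ ?_
      · rintro _ ⟨f, hf, rfl⟩
        simpa using (hlt f hf.1).trans_le h
      · rw [(hφ.injOn_edgeNbhd he).ncard_image, hG.ncard_edgeNbhd he,
          Set.ncard_coe_finset, Finset.card_range]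
    obtain ⟨f, hf, hf0⟩ : 0 ∈ φ '' G.edgeNbhd e := by
      rw [himg]
      simp only [Finset.coe_range, Set.mem_Iio]
      omega
    exact ⟨f, ⟨hf, hf0⟩, fun f' hf' => hφ.injOn_edgeNbhd he hf'.1 hf (hf'.2.trans hf0.symm)⟩
  have hcount := Finset.card_mul_eq_card_mul (fun e f : Sym2 V => ∃ v, v ∈ e ∧ v ∈ f)
    (s := G.edgeFinset) (t := G.edgeFinset.filter (φ · = 0)) (m := 1) (n := 2 * k - 1) ?_ ?_
  · rw [mul_one] at hcount
    exact hcount ▸ dvd_mul_left _ _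
  · intro e he
    obtain ⟨f, hf, huniq⟩ := hex e (mem_edgeFinset.1 he)
    refine Finset.card_eq_one.2 ⟨f, Finset.eq_singleton_iff_unique_mem.2 ⟨?_, fun f' hf' => ?_⟩⟩
    · simpa [Finset.bipartiteAbove, edgeNbhd, and_right_comm] using hf
    · refine huniq f' ?_
      simpa [Finset.bipartiteAbove, edgeNbhd, and_right_comm] using hf'
  · intro f hf
    rw [← hG.ncard_edgeNbhd (mem_edgeFinset.1 (Finset.mem_filter.1 hf).1), ← Set.ncard_coe_finset]
    congr 1
    ext e
    simp [Finset.bipartiteBelow, edgeNbhd, and_comm]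

end SimpleGraph

/-- For every positive integer `g` and every integer `k ≥ 2`, there exists a simple
`k`-regular bipartite graph `G` with girth at least `g` and `χ'ₛ(G) ≥ 2k`. -/
theorem stmt0 (g k : ℕ) (hg : 0 < g) (hk : 2 ≤ k) :
    ∃ (V : Type) (_ : Fintype V) (G : SimpleGraph V),
      G.IsKRegular k ∧ G.Colorable 2 ∧ (g : ℕ∞) ≤ G.egirth ∧
        2 * k ≤ G.strongChromaticIndex := by
  classical
  obtain ⟨V, _, G, hreg, hcol, hgirth, m, hm⟩ := exists_isKRegular_bipartite_egirth g k
  refine ⟨V, inferInstance, G, hreg, hcol, hgirth, ?_⟩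
  by_contra! hlt
  have hdvd := hreg.dvd_card_edgeFinset (by omega) (Nat.le_sub_one_of_lt hlt)
  have hsum := G.sum_degrees_eq_twice_card_edges
  simp only [hreg.degree_eq, Finset.sum_const, Finset.card_univ, smul_eq_mul, hm] at hsum
  have hk' : Nat.Coprime (2 * k - 1) k := by
    obtain ⟨j, rfl⟩ := Nat.exists_eq_add_of_le' (show 1 ≤ k by omega)
    rw [show 2 * (j + 1) - 1 = j + (j + 1) by omega]
    simp
  have h2 : Nat.Coprime (2 * k - 1) (2 ^ m) :=
    Nat.Coprime.pow_right _ (Nat.coprime_two_right.2 ⟨k - 1, by omega⟩)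
  have h1 : 2 * k - 1 ∣ 2 ^ m * k * k := hsum ▸ hdvd.mul_left 2
  have := Nat.Coprime.eq_one_of_dvd ((h2.mul_right hk').mul_right hk') h1
  omega
end

section
/- Fix integers k ≥ 2, g ≥ 3, and n ≥ g. If in addition n ≥ ⌈3(k−1)^{g−1}/(k−2)⌉ whenever k ≥ 3, then there exists a simple k-regular bipartite graph on 2n vertices with girth at least g. -/
open SimpleGraph Finset

namespace SimpleGraph

variable {V : Type*}

/-- Every walk from `a` to `b` in `G` has length at least `g - 1`. -/
def WalksLong (G : SimpleGraph V) (g : ℕ) (a b : V) : Prop :=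
  ∀ p : G.Walk a b, g ≤ p.length + 1

/-- A walk-based form of `g ≤ girth`: deleting an edge leaves its endpoints at distance at
least `g - 1`. -/
def DetoursLong (G : SimpleGraph V) (g : ℕ) : Prop :=
  ∀ u v, G.Adj u v → (G.deleteEdges {s(u, v)}).WalksLong g u v

theorem WalksLong.mono {G H : SimpleGraph V} {g : ℕ} {a b : V} (h : H.WalksLong g a b)
    (hle : G ≤ H) : G.WalksLong g a b := fun p ↦ by
  simpa using h (p.mapLe hle)

theorem WalksLong.symm {G : SimpleGraph V} {g : ℕ} {a b : V} (h : G.WalksLong g a b) :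
    G.WalksLong g b a := fun p ↦ by
  simpa using h p.reverse

theorem DetoursLong.mono {G H : SimpleGraph V} {g : ℕ} (h : H.DetoursLong g) (hle : G ≤ H) :
    G.DetoursLong g := fun u v huv ↦
  (h u v (hle huv)).mono (deleteEdges_mono hle)

theorem DetoursLong.le_egirth {G : SimpleGraph V} {g : ℕ} (h : G.DetoursLong g) :
    (g : ℕ∞) ≤ G.egirth := by
  classical
  rw [SimpleGraph.le_egirth]
  intro a w hw
  cases w with
  | nil => exact absurd rfl hw.ne_nil
  | cons hadj p =>
    obtain ⟨-, hp⟩ := (Walk.cons_isCycle_iff p hadj).1 hw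
    rename_i b
    have hp' : ∀ e ∈ p.edges, e ∈ (G.deleteEdges {s(a, b)}).edgeSet := by
      intro e he
      rw [edgeSet_deleteEdges]
      refine ⟨p.edges_subset_edgeSet he, ?_⟩
      rintro rfl
      exact hp he
    have := (h a b hadj).symm (p.transfer _ hp')
    rw [Walk.length_transfer] at this
    simpa using (Nat.cast_le (α := ℕ∞)).2 this

/-- A walk after adding an edge either needs no new edge, or can be cut at the new edge. -/
theorem exists_walk_of_walk_sup_edge {G : SimpleGraph V} {a b u w : V}
    (p : (G ⊔ edge a b).Walk u w) :
    (∃ q : G.Walk u w, q.length ≤ p.length) ∨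
    (∃ (q : G.Walk u a) (r : G.Walk b w), q.length + 1 + r.length ≤ p.length) ∨
    (∃ (q : G.Walk u b) (r : G.Walk a w), q.length + 1 + r.length ≤ p.length) := by
  induction p with
  | nil => exact .inl ⟨.nil, le_rfl⟩
  | @cons u v w h p ih =>
    rw [sup_adj] at h
    rcases h with h | h
    · rcases ih with ⟨q, hq⟩ | ⟨q, r, hq⟩ | ⟨q, r, hq⟩
      · exact .inl ⟨.cons h q, by simpa using hq⟩
      · exact .inr (.inl ⟨.cons h q, r, by simp only [Walk.length_cons]; omega⟩)
      · exact .inr (.inr ⟨.cons h q, r, by simp only [Walk.length_cons]; omega⟩)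
    · rw [edge_adj] at h
      obtain ⟨⟨rfl, rfl⟩ | ⟨rfl, rfl⟩, -⟩ := h
      · rcases ih with ⟨q, hq⟩ | ⟨q, r, hq⟩ | ⟨q, r, hq⟩
        · exact .inr (.inl ⟨.nil, q, by simp only [Walk.length_cons, Walk.length_nil]; omega⟩)
        · exact .inr (.inl ⟨.nil, r, by simp only [Walk.length_cons, Walk.length_nil]; omega⟩)
        · exact .inl ⟨r, by simp only [Walk.length_cons]; omega⟩
      · rcases ih with ⟨q, hq⟩ | ⟨q, r, hq⟩ | ⟨q, r, hq⟩
        · exact .inr (.inr ⟨.nil, q, by simp only [Walk.length_cons, Walk.length_nil]; omega⟩)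
        · exact .inl ⟨r, by simp only [Walk.length_cons]; omega⟩
        · exact .inr (.inr ⟨.nil, r, by simp only [Walk.length_cons, Walk.length_nil]; omega⟩)

theorem DetoursLong.sup_edge {G : SimpleGraph V} {g : ℕ} {a b : V} (h : G.DetoursLong g)
    (hab : G.WalksLong g a b) : (G ⊔ edge a b).DetoursLong g := by
  intro u v huv
  by_cases he : s(u, v) = s(a, b)
  · have hle : (G ⊔ edge a b).deleteEdges {s(u, v)} ≤ G := by
      intro c d hcd
      simp only [deleteEdges_adj, sup_adj, Set.mem_singleton_iff, adj_edge] at hcd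
      grind
    rcases Sym2.eq_iff.1 he with ⟨rfl, rfl⟩ | ⟨rfl, rfl⟩
    · exact hab.mono hle
    · exact hab.symm.mono hle
  · have huv' : G.Adj u v := by
      simp only [sup_adj, adj_edge] at huv
      grind
    have hle : (G ⊔ edge a b).deleteEdges {s(u, v)} ≤ G.deleteEdges {s(u, v)} ⊔ edge a b := by
      intro c d hcd
      simp only [deleteEdges_adj, sup_adj] at hcd ⊢
      tauto
    have hd := deleteEdges_le (G := G) {s(u, v)}
    intro p
    rcases exists_walk_of_walk_sup_edge (p.mapLe hle) with ⟨q, hq⟩ | ⟨q, r, hq⟩ | ⟨q, r, hq⟩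
    · have := h u v huv' q
      simp only [Walk.length_map] at hq
      omega
    · have := hab ((q.mapLe hd).reverse.append (.cons huv' (r.mapLe hd).reverse))
      simp at hq this
      omega
    · have := hab ((r.mapLe hd).append (.cons huv'.symm (q.mapLe hd)))
      simp at hq this
      omega

theorem neighborSet_sup_edge_subset {G : SimpleGraph V} {a b w : V} (ha : w ≠ a) (hb : w ≠ b) :
    (G ⊔ edge a b).neighborSet w ⊆ G.neighborSet w := by
  intro z hz
  simp only [mem_neighborSet, sup_adj, edge_adj] at hz ⊢
  tauto

theorem ncard_neighborSet_sup_edge_le [Finite V] {G : SimpleGraph V} {a b : V} (w : V) :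
    ((G ⊔ edge a b).neighborSet w).ncard ≤ (G.neighborSet w).ncard + 1 := by
  have : ∃ c, (G ⊔ edge a b).neighborSet w ⊆ insert c (G.neighborSet w) := by
    by_cases h : w = a
    · refine ⟨b, fun z hz ↦ ?_⟩
      simp only [mem_neighborSet, sup_adj, edge_adj, Set.mem_insert_iff] at hz ⊢
      grind
    · refine ⟨a, fun z hz ↦ ?_⟩
      simp only [mem_neighborSet, sup_adj, edge_adj, Set.mem_insert_iff] at hz ⊢
      tauto
  obtain ⟨c, hc⟩ := this
  exact (Set.ncard_le_ncard hc (Set.toFinite _)).trans (Set.ncard_insert_le _ _)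

theorem ncard_neighborSet_mono [Finite V] {G H : SimpleGraph V} (h : G ≤ H) (w : V) :
    (G.neighborSet w).ncard ≤ (H.neighborSet w).ncard :=
  Set.ncard_le_ncard (fun _ hz ↦ h hz) (Set.toFinite _)

theorem ncard_neighborSet_deleteEdges_lt [Finite V] {G : SimpleGraph V} {u v : V}
    (h : G.Adj u v) :
    ((G.deleteEdges {s(u, v)}).neighborSet u).ncard < (G.neighborSet u).ncard := by
  refine Set.ncard_lt_ncard ⟨fun z hz ↦ deleteEdges_le _ hz, fun hs ↦ ?_⟩ (Set.toFinite _)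
  have := hs (show v ∈ G.neighborSet u from h)
  simp at this

/-- A bound on the number of vertices reachable by walks of length less than `m` from a
vertex of degree at most `q`, in a graph of maximum degree at most `q + 1`. -/
theorem ncard_ball_le [Finite V] {G : SimpleGraph V} {q : ℕ} {x : V}
    (hdeg : ∀ w, (G.neighborSet w).ncard ≤ q + 1) (hx : (G.neighborSet x).ncard ≤ q) (m : ℕ) :
    {w | ∃ p : G.Walk x w, p.length < m}.ncard ≤ ∑ i ∈ range m, q ^ i := by
  classical
  have := Fintype.ofFinite V
  have hsphere : ∀ i : ℕ, {w | G.edist x w = i}.ncard ≤ q ^ i := by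
    intro i
    induction i with
    | zero =>
      have : {w | G.edist x w = (0 : ℕ)} = {x} := by
        ext w
        simp [eq_comm (a := w)]
      rw [this]
      simp
    | succ i ih =>
      have hsub : {w | G.edist x w = (i + 1 : ℕ)} ⊆
          ⋃ z ∈ {w | G.edist x w = i}.toFinset,
            {w ∈ G.neighborSet z | G.edist x w = (i + 1 : ℕ)} := by
        intro w hw
        obtain ⟨p, hp⟩ := exists_walk_of_edist_eq_coe hw
        have hnil : ¬ p.Nil := by
          rw [← Walk.length_eq_zero_iff]
          omega
        have hadj := p.adj_penultimate hnil
        have hle : G.edist x p.penultimate ≤ i := by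
          refine (edist_le p.dropLast).trans ?_
          simp [hp]
        have hge : ((i + 1 : ℕ) : ℕ∞) ≤ G.edist x p.penultimate + 1 := by
          rw [Set.mem_ofPred_eq] at hw
          rw [← hw]
          refine (G.edist_triangle (v := p.penultimate)).trans ?_
          gcongr
          exact (edist_eq_one_iff_adj.2 hadj).le
        have heq : G.edist x p.penultimate = i := by
          refine le_antisymm hle ?_
          simpa using hge
        simp only [Set.mem_iUnion]
        exact ⟨p.penultimate, by simpa using heq, hadj, hw⟩
      have hbound : ∀ z ∈ {w | G.edist x w = i}.toFinset,
          {w ∈ G.neighborSet z | G.edist x w = (i + 1 : ℕ)}.ncard ≤ q := by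
        intro z hz
        have hz : G.edist x z = i := by simpa using hz
        cases i with
        | zero =>
          obtain rfl : x = z := by simpa using hz
          exact (Set.ncard_le_ncard (Set.sep_subset _ _) (Set.toFinite _)).trans hx
        | succ j =>
          obtain ⟨p, hp⟩ := exists_walk_of_edist_eq_coe hz
          have hnil : ¬ p.Nil := by
            rw [← Walk.length_eq_zero_iff]
            omega
          have hadj := p.adj_penultimate hnil
          have hle : G.edist x p.penultimate ≤ j := by
            refine (edist_le p.dropLast).trans ?_
            simp [hp]
          have : {w ∈ G.neighborSet z | G.edist x w = (j + 1 + 1 : ℕ)} ⊂ G.neighborSet z := by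
            refine ⟨Set.sep_subset _ _, fun hs ↦ ?_⟩
            have := (hs hadj.symm).2
            rw [this] at hle
            norm_cast at hle
            omega
          have := (Set.ncard_lt_ncard this (Set.toFinite _)).trans_le (hdeg z)
          omega
      refine (Set.ncard_le_ncard hsub (Set.toFinite _)).trans ?_
      refine (Finset.set_ncard_biUnion_le _ _).trans ?_
      refine (Finset.sum_le_card_nsmul _ _ _ hbound).trans ?_
      rw [smul_eq_mul, ← Set.ncard_eq_toFinset_card', pow_succ]
      gcongr
  have hsub : {w | ∃ p : G.Walk x w, p.length < m} ⊆
      ⋃ i ∈ range m, {w | G.edist x w = (i : ℕ)} := by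
    rintro w ⟨p, hp⟩
    have hne : G.edist x w ≠ ⊤ := ne_top_of_le_ne_top (ENat.natCast_ne_top _) (edist_le p)
    obtain ⟨i, hi⟩ := ENat.ne_top_iff_exists.1 hne
    have hle := edist_le p
    rw [← hi] at hle
    simp only [Set.mem_iUnion]
    refine ⟨i, ?_, hi.symm⟩
    rw [Finset.mem_range]
    exact lt_of_le_of_lt (by exact_mod_cast hle) hp
  refine (Set.ncard_le_ncard hsub (Set.toFinite _)).trans ?_
  exact (Finset.set_ncard_biUnion_le _ _).trans (Finset.sum_le_sum fun i _ ↦ hsphere i)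

/-- Bipartite graphs with parts `s`, `t`, maximum degree at most `k` and girth at least `g`. -/
structure IsSparseBipartite (G : SimpleGraph V) (s t : Set V) (k g : ℕ) : Prop where
  isBipartiteWith : G.IsBipartiteWith s t
  ncard_le : ∀ w, (G.neighborSet w).ncard ≤ k
  detoursLong : G.DetoursLong g

theorem IsSparseBipartite.mono [Finite V] {G H : SimpleGraph V} {s t : Set V} {k g : ℕ}
    (h : H.IsSparseBipartite s t k g) (hle : G ≤ H) : G.IsSparseBipartite s t k g where
  isBipartiteWith := ⟨h.isBipartiteWith.disjoint, fun _ _ huv ↦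
    h.isBipartiteWith.mem_of_adj (hle huv)⟩
  ncard_le w := (ncard_neighborSet_mono hle w).trans (h.ncard_le w)
  detoursLong := h.detoursLong.mono hle

theorem IsSparseBipartite.symm {G : SimpleGraph V} {s t : Set V} {k g : ℕ}
    (h : G.IsSparseBipartite s t k g) : G.IsSparseBipartite t s k g :=
  ⟨h.isBipartiteWith.symm, h.ncard_le, h.detoursLong⟩

theorem IsSparseBipartite.sup_edge [Finite V] {G : SimpleGraph V} {s t : Set V} {k g : ℕ}
    {a b : V} (h : G.IsSparseBipartite s t k g) (ha : a ∈ s) (hb : b ∈ t)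
    (hak : (G.neighborSet a).ncard < k) (hbk : (G.neighborSet b).ncard < k)
    (hab : G.WalksLong g a b) : (G ⊔ edge a b).IsSparseBipartite s t k g where
  isBipartiteWith := by
    refine ⟨h.isBipartiteWith.disjoint, fun u v huv ↦ ?_⟩
    rw [sup_adj, edge_adj] at huv
    rcases huv with huv | ⟨⟨rfl, rfl⟩ | ⟨rfl, rfl⟩, -⟩
    · exact h.isBipartiteWith.mem_of_adj huv
    · exact .inl ⟨ha, hb⟩
    · exact .inr ⟨hb, ha⟩
  ncard_le w := by
    by_cases hw : w = a ∨ w = b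
    · refine (ncard_neighborSet_sup_edge_le w).trans ?_
      rcases hw with rfl | rfl <;> omega
    · rw [not_or] at hw
      exact (Set.ncard_le_ncard (neighborSet_sup_edge_subset hw.1 hw.2) (Set.toFinite _)).trans
        (h.ncard_le w)
  detoursLong := h.detoursLong.sup_edge hab

theorem WalksLong.not_adj {G : SimpleGraph V} {g : ℕ} {a b : V} (hg : 3 ≤ g)
    (h : G.WalksLong g a b) : ¬ G.Adj a b := fun hadj ↦ by
  have := h hadj.toWalk
  simp at this
  omega

theorem ncard_edgeSet_sup_edge [Finite V] {G : SimpleGraph V} {a b : V} (hne : a ≠ b)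
    (hab : ¬ G.Adj a b) : (G ⊔ edge a b).edgeSet.ncard = G.edgeSet.ncard + 1 := by
  rw [edgeSet_sup, edgeSet_edge_of_ne hne, Set.union_singleton,
    Set.ncard_insert_of_notMem (mt (mem_edgeSet G).1 hab) (Set.toFinite _)]

theorem ncard_edgeSet_deleteEdges_singleton [Finite V] {G : SimpleGraph V} {a b : V}
    (hab : G.Adj a b) : (G.deleteEdges {s(a, b)}).edgeSet.ncard + 1 = G.edgeSet.ncard := by
  rw [edgeSet_deleteEdges,
    Set.ncard_sdiff_singleton_add_one ((mem_edgeSet G).2 hab) (Set.toFinite _)]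

/-- Replacing an edge `uv` by two edges `xv` and `uy`. -/
theorem IsSparseBipartite.exists_switch [Finite V] {G : SimpleGraph V} {s t : Set V} {k g : ℕ}
    {x y u v : V} (hg : 3 ≤ g) (h : G.IsSparseBipartite s t k g) (hx : x ∈ s) (hy : y ∈ t)
    (hu : u ∈ s) (hv : v ∈ t) (hxk : (G.neighborSet x).ncard < k)
    (hyk : (G.neighborSet y).ncard < k) (huv : G.Adj u v) (hxv : G.WalksLong g x v)
    (huy : G.WalksLong g u y) :
    ∃ H : SimpleGraph V, H.IsSparseBipartite s t k g ∧ G.edgeSet.ncard < H.edgeSet.ncard := by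
  have hst : ∀ {a b}, a ∈ s → b ∈ t → a ≠ b := fun ha hb ↦
    h.isBipartiteWith.disjoint.ne_of_mem ha hb
  have hux : u ≠ x := by
    rintro rfl
    exact hxv.not_adj hg huv
  have hyv : y ≠ v := by
    rintro rfl
    exact huy.not_adj hg huv
  set G₁ := G.deleteEdges {s(u, v)} with hG₁
  have hle : G₁ ≤ G := deleteEdges_le _
  have h₁ : G₁.IsSparseBipartite s t k g := h.mono hle
  have hu₁ : (G₁.neighborSet u).ncard < k :=
    (ncard_neighborSet_deleteEdges_lt huv).trans_le (h.ncard_le u)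
  have hv₁ : (G₁.neighborSet v).ncard < k := by
    rw [hG₁, Sym2.eq_swap]
    exact (ncard_neighborSet_deleteEdges_lt huv.symm).trans_le (h.ncard_le v)
  have hx₁ := (ncard_neighborSet_mono hle x).trans_lt hxk
  have hy₁ := (ncard_neighborSet_mono hle y).trans_lt hyk
  have h₂ := h₁.sup_edge hx hv hx₁ hv₁ (hxv.mono hle)
  have hu₂ := (Set.ncard_le_ncard (neighborSet_sup_edge_subset (G := G₁) hux (hst hu hv))
    (Set.toFinite _)).trans_lt hu₁
  have hy₂ := (Set.ncard_le_ncard (neighborSet_sup_edge_subset (G := G₁) (hst hx hy).symm hyv)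
    (Set.toFinite _)).trans_lt hy₁
  have huy₂ : (G₁ ⊔ edge x v).WalksLong g u y := by
    intro p
    rcases exists_walk_of_walk_sup_edge p with ⟨q, hq⟩ | ⟨q, r, hq⟩ | ⟨q, r, hq⟩
    · have := huy (q.mapLe hle)
      simp at this
      omega
    · have h1 := hxv ((q.mapLe hle).reverse.concat huv)
      have h2 := huy (.cons huv (r.mapLe hle))
      simp at h1 h2
      omega
    · have := h.detoursLong u v huv q
      omega
  refine ⟨G₁ ⊔ edge x v ⊔ edge u y, h₂.sup_edge hu hy hu₂ hy₂ huy₂, ?_⟩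
  rw [ncard_edgeSet_sup_edge (hst hu hy) (huy₂.not_adj hg),
    ncard_edgeSet_sup_edge (hst hx hv) ((hxv.mono hle).not_adj hg),
    ncard_edgeSet_deleteEdges_singleton huv]
  exact Nat.lt_succ_self _

theorem IsBipartiteWith.exists_ncard_lt [Finite V] {G : SimpleGraph V} {s t : Finset V} {k : ℕ}
    (h : G.IsBipartiteWith s t) (hcard : #s = #t) (hk : ∀ w, (G.neighborSet w).ncard ≤ k)
    {x : V} (hx : x ∈ s) (hxk : (G.neighborSet x).ncard < k) :
    ∃ y ∈ t, (G.neighborSet y).ncard < k := by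
  classical
  have := Fintype.ofFinite V
  have hdeg : ∀ w, (G.neighborSet w).ncard = G.degree w := fun w ↦ by
    rw [Set.ncard_eq_toFinset_card', ← neighborFinset_def, card_neighborFinset_eq_degree]
  simp only [hdeg] at *
  have hsum := isBipartiteWith_sum_degrees_eq h
  by_contra! hcon
  have h1 : ∑ v ∈ s, G.degree v < ∑ v ∈ s, k := Finset.sum_lt_sum (fun w _ ↦ hk w) ⟨x, hx, hxk⟩
  have h2 : ∑ v ∈ t, k ≤ ∑ v ∈ t, G.degree v := Finset.sum_le_sum hcon
  simp only [Finset.sum_const, hcard] at h1 h2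
  omega

theorem exists_isKRegular_detoursLong [Finite V] {s t : Finset V} {q g : ℕ} (hg : 3 ≤ g)
    (hdisj : Disjoint s t) (hunion : ∀ w, w ∈ s ∨ w ∈ t) (hcard : #s = #t)
    (hlarge : 2 * ∑ i ∈ range (g - 1), q ^ i < #t) :
    ∃ G : SimpleGraph V, G.IsKRegular (q + 1) ∧ G.IsBipartiteWith s t ∧ G.DetoursLong g := by
  classical
  have := Fintype.ofFinite V
  obtain ⟨G, hG, hmax⟩ := Set.exists_max_image
    {G : SimpleGraph V | G.IsSparseBipartite s t (q + 1) g} (fun G ↦ G.edgeSet.ncard)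
    (Set.toFinite _) ⟨⊥, ⟨⟨by exact_mod_cast hdisj, fun _ _ h ↦ h.elim⟩,
      fun w ↦ by simp [neighborSet], fun _ _ h ↦ h.elim⟩⟩
  refine ⟨G, ?_, hG.isBipartiteWith, hG.detoursLong⟩
  by_contra hreg
  obtain ⟨x, hx, y, hy, hxk, hyk⟩ : ∃ x ∈ s, ∃ y ∈ t, (G.neighborSet x).ncard < q + 1 ∧
      (G.neighborSet y).ncard < q + 1 := by
    simp only [IsKRegular, not_forall] at hreg
    obtain ⟨w, hw⟩ := hreg
    have hw := lt_of_le_of_ne (hG.ncard_le w) hw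
    rcases hunion w with hws | hwt
    · obtain ⟨y, hy, hyk⟩ := hG.isBipartiteWith.exists_ncard_lt hcard hG.ncard_le hws hw
      exact ⟨w, hws, y, hy, hw, hyk⟩
    · obtain ⟨x, hx, hxk⟩ :=
        hG.isBipartiteWith.symm.exists_ncard_lt hcard.symm hG.ncard_le hwt hw
      exact ⟨x, hx, w, hwt, hxk, hw⟩
  have hball : ∀ z, (G.neighborSet z).ncard < q + 1 →
      #{w | ¬ G.WalksLong g z w} ≤ ∑ i ∈ range (g - 1), q ^ i := by
    intro z hz
    refine le_trans (le_of_eq ?_) (ncard_ball_le hG.ncard_le (Nat.lt_succ_iff.1 hz) (g - 1))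
    rw [Set.ncard_eq_toFinset_card']
    congr 1
    ext w
    simp only [WalksLong, not_forall, Finset.mem_filter, Finset.mem_univ, true_and,
      Set.mem_toFinset, Set.mem_ofPred_eq]
    exact exists_congr fun p ↦ by omega
  have hyT : ∀ v ∈ t, G.WalksLong g x v → (G.neighborSet v).ncard = q + 1 := by
    intro v hv hxv
    by_contra hvk
    have hvk := lt_of_le_of_ne (hG.ncard_le v) hvk
    have := hmax _ (hG.sup_edge hx hv hxk hvk hxv)
    rw [ncard_edgeSet_sup_edge (hG.isBipartiteWith.disjoint.ne_of_mem hx hv)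
      (hxv.not_adj hg)] at this
    omega
  have hnear : ∀ v ∈ t, G.WalksLong g x v → ∀ u, G.Adj v u → ¬ G.WalksLong g y u := by
    intro v hv hxv u huv huy
    have hu := hG.isBipartiteWith.symm.mem_of_mem_adj hv huv
    obtain ⟨H, hH, hlt⟩ :=
      hG.exists_switch hg hx hy hu hv hxk hyk huv.symm hxv huy.symm
    exact absurd (hmax H hH) (not_le.2 hlt)
  have hcount : #{v ∈ t | G.WalksLong g x v} * (q + 1) ≤
      #{w | ¬ G.WalksLong g y w} * (q + 1) := by
    refine Finset.card_mul_le_card_mul G.Adj (fun v hv ↦ ?_) (fun u hu ↦ ?_)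
    · rw [Finset.mem_filter] at hv
      rw [← hyT v hv.1 hv.2, Set.ncard_eq_toFinset_card']
      refine Finset.card_le_card fun u hu ↦ ?_
      have hu : G.Adj v u := by simpa using hu
      simpa [Finset.bipartiteAbove, hu] using hnear v hv.1 hv.2 u hu
    · refine le_trans ?_ (hG.ncard_le u)
      rw [Set.ncard_eq_toFinset_card']
      refine Finset.card_le_card fun v hv ↦ ?_
      simpa using (Finset.mem_filter.1 hv).2.symm
  have hcount := Nat.le_of_mul_le_mul_right hcount (Nat.succ_pos q)
  have hsplit := Finset.card_filter_add_card_filter_not (s := t) (fun v ↦ G.WalksLong g x v)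
  have hsub : #{v ∈ t | ¬ G.WalksLong g x v} ≤ #{w | ¬ G.WalksLong g x w} :=
    Finset.card_le_card (Finset.filter_subset_filter _ (Finset.subset_univ t))
  have := hball x hxk
  have := hball y hyk
  omega

theorem Walk.le_add_length {G : SimpleGraph V} {f : V → ℕ}
    (hf : ∀ a b, G.Adj a b → f a ≤ f b + 1) {u v : V} (p : G.Walk u v) :
    f u ≤ f v + p.length := by
  induction p with
  | nil => simp
  | cons h p ih =>
    have := hf _ _ h
    rw [Walk.length_cons]
    omega

theorem detoursLong_cycleGraph (m : ℕ) : (cycleGraph m).DetoursLong m := by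
  have key : ∀ u v : Fin m, (v - u).val = 1 →
      ((cycleGraph m).deleteEdges {s(u, v)}).WalksLong m u v := by
    intro u v huv
    have hval : ∀ a b : Fin m,
        (a - b).val = if b ≤ a then a.val - b.val else m + a.val - b.val := by
      intro a b
      split_ifs with hab
      · exact Fin.sub_val_of_le hab
      · exact Fin.coe_sub_iff_lt.2 (not_le.1 hab)
    simp only [hval, Fin.le_def] at huv
    intro p
    have := p.le_add_length (f := fun w ↦ (w - v).val) fun a b h ↦ by
      rw [deleteEdges_adj, cycleGraph_adj', Set.mem_singleton_iff] at h
      obtain ⟨hab, hne⟩ := h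
      have hne : ¬ (a.val = u.val ∧ b.val = v.val) := fun h ↦
        hne (by rw [Fin.ext h.1, Fin.ext h.2])
      simp only [hval, Fin.le_def] at *
      grind
    simp only [hval, Fin.le_def] at this
    grind
  intro u v huv
  rcases cycleGraph_adj'.1 huv with h | h
  · rw [Sym2.eq_swap]
    exact (key v u h).symm
  · exact key u v h

theorem isKRegular_cycleGraph {m : ℕ} (hm : 3 ≤ m) : (cycleGraph m).IsKRegular 2 := by
  obtain ⟨m, rfl⟩ := Nat.exists_eq_add_of_le' hm
  intro v
  rw [Set.ncard_eq_toFinset_card', ← neighborFinset_def, card_neighborFinset_eq_degree,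
    cycleGraph_degree_three_le]

end SimpleGraph

/-- For `k ≥ 2`, `g ≥ 3`, `n ≥ g`, and (when `k ≥ 3`) `n ≥ ⌈3(k-1)^(g-1)/(k-2)⌉`, there
exists a simple `k`-regular bipartite graph on `2n` vertices with girth at least `g`. -/
theorem stmt4 (k g n : ℕ) (hk : 2 ≤ k) (hg : 3 ≤ g) (hn : g ≤ n)
    (hn' : 3 ≤ k → ⌈(3 * ((k : ℚ) - 1) ^ (g - 1)) / ((k : ℚ) - 2)⌉ ≤ (n : ℤ)) :
    ∃ G : SimpleGraph (Fin (2 * n)),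
      G.IsKRegular k ∧ G.Colorable 2 ∧ (g : ℕ∞) ≤ G.egirth := by
  rcases hk.eq_or_lt with rfl | hk
  · refine ⟨cycleGraph (2 * n), isKRegular_cycleGraph (by omega), ?_, ?_⟩
    · simpa using (cycleGraph.bicoloring_of_even (2 * n) (even_two_mul n)).colorable
    · refine le_trans ?_ (detoursLong_cycleGraph (2 * n)).le_egirth
      exact_mod_cast (by omega : g ≤ 2 * n)
  · obtain ⟨q, rfl⟩ : ∃ q, k = q + 1 := ⟨k - 1, by omega⟩
    have hq : (0 : ℚ) < (q : ℚ) - 1 := by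
      have : (2 : ℚ) ≤ q := by exact_mod_cast (by omega : 2 ≤ q)
      linarith
    have hn' := Int.ceil_le.1 (hn' hk)
    push_cast at hn'
    rw [show (q : ℚ) + 1 - 1 = q by ring, show (q : ℚ) + 1 - 2 = q - 1 by ring,
      div_le_iff₀ hq] at hn'
    have hlarge : 2 * ∑ i ∈ range (g - 1), q ^ i < n := by
      have hgeom := mul_geom_sum (q : ℚ) (g - 1)
      have hpos : (0 : ℚ) ≤ (q : ℚ) ^ (g - 1) := by positivity
      have : (2 : ℚ) * ∑ i ∈ range (g - 1), (q : ℚ) ^ i < n := by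
        refine lt_of_mul_lt_mul_left ?_ hq.le
        linarith
      exact_mod_cast this
    let s : Finset (Fin (2 * n)) := {v | v.val < n}
    have hs : #s = n := by
      simp [s, Fin.card_filter_val_lt]
      omega
    have hsc : #sᶜ = n := by
      rw [Finset.card_compl, hs, Fintype.card_fin]
      omega
    obtain ⟨G, hreg, hbip, hlong⟩ := exists_isKRegular_detoursLong (t := sᶜ) hg
      disjoint_compl_right (fun w ↦ by simpa using em (w ∈ s)) (hs.trans hsc.symm)
      (hlarge.trans_eq hsc.symm)
    exact ⟨G, hreg, isBipartite_iff_exists_isBipartiteWith.2 ⟨_, _, hbip⟩, hlong.le_egirth⟩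
end

section
/- Let k ≥ 2 and let G be a simple k-regular bipartite graph on 2n vertices, where n is a positive integer not divisible by 2k−1. Then the strong chromatic index of G satisfies χ'_s(G) ≥ 2k. -/
open SimpleGraph Finset

theorem SimpleGraph.IsKRegular.isRegularOfDegree {V : Type*} {G : SimpleGraph V}
    [G.LocallyFinite] {k : ℕ} (hreg : G.IsKRegular k) : G.IsRegularOfDegree k := fun v => by
  rw [← hreg v, Set.ncard_eq_toFinset_card', ← G.card_neighborFinset_eq_degree]; rfl

open Classical in
/-- In a `k`-regular graph every edge meets exactly `2k - 1` edges, itself included. -/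
theorem SimpleGraph.IsKRegular.card_edges_meeting {V : Type*} [Fintype V] {G : SimpleGraph V}
    {k : ℕ} (hreg : G.IsKRegular k) {e : Sym2 V} (he : e ∈ G.edgeSet) :
    #{f ∈ G.edgeFinset | ∃ v, v ∈ e ∧ v ∈ f} = 2 * k - 1 := by
  have hdeg := hreg.isRegularOfDegree
  induction e with | _ u w =>
  have hadj : G.Adj u w := he
  have hunion : {f ∈ G.edgeFinset | ∃ v, v ∈ s(u, w) ∧ v ∈ f}
      = G.incidenceFinset u ∪ G.incidenceFinset w := by
    ext f
    simp [SimpleGraph.incidenceSet, and_or_left, or_and_right, exists_or]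
  have hinter : G.incidenceFinset u ∩ G.incidenceFinset w = {s(u, w)} := by
    rw [← Finset.coe_inj]
    simpa using G.incidenceSet_inter_incidenceSet_of_adj hadj
  have h := Finset.card_union_add_card_inter (G.incidenceFinset u) (G.incidenceFinset w)
  rw [hinter, card_singleton, card_incidenceFinset_eq_degree, card_incidenceFinset_eq_degree,
    hdeg.degree_eq, hdeg.degree_eq] at h
  rw [hunion]
  omega

/-- Edges meeting a common edge receive distinct colors in a strong edge-coloring. -/
theorem SimpleGraph.IsStrongEdgeColoring.eq_of_meets {V : Type*} {G : SimpleGraph V}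
    {φ : Sym2 V → ℕ} (hφ : G.IsStrongEdgeColoring φ) {e f g : Sym2 V} (he : e ∈ G.edgeSet)
    (hf : f ∈ G.edgeSet) (hg : g ∈ G.edgeSet) (hef : ∃ v, v ∈ e ∧ v ∈ f)
    (heg : ∃ v, v ∈ e ∧ v ∈ g) (h : φ f = φ g) : f = g := by
  by_contra hne
  obtain ⟨v, hve, hvf⟩ := hef
  exact hφ f hf g hg ⟨hne, Or.inr ⟨e, he, ⟨v, hvf, hve⟩, heg⟩⟩ h

/-- A finite graph has a strong edge-coloring with `χ'ₛ(G)` colors. -/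
theorem SimpleGraph.exists_isStrongEdgeColoring_lt_strongChromaticIndex {V : Type*} [Finite V]
    (G : SimpleGraph V) :
    ∃ φ : Sym2 V → ℕ, G.IsStrongEdgeColoring φ ∧ ∀ e ∈ G.edgeSet, φ e < G.strongChromaticIndex := by
  obtain ⟨m, ⟨i⟩⟩ := Finite.exists_equiv_fin (Sym2 V)
  have hne : {n | ∃ φ : Sym2 V → ℕ, G.IsStrongEdgeColoring φ ∧
      ∀ e ∈ G.edgeSet, φ e < n}.Nonempty :=
    ⟨m, fun e => i e, fun e _ f _ h heq => h.1 (i.injective (Fin.ext heq)), fun e _ => (i e).2⟩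
  exact Nat.sInf_mem hne

open Classical in
/-- If a `k`-regular graph has a strong edge-coloring with fewer than `2k` colors, then `2k - 1`
divides its number of edges. -/
theorem SimpleGraph.IsKRegular.dvd_card_edgeFinset_s8 {V : Type*} [Fintype V] {G : SimpleGraph V}
    {k m : ℕ} (hk : 0 < k) (hreg : G.IsKRegular k) {φ : Sym2 V → ℕ}
    (hφ : G.IsStrongEdgeColoring φ) (hm : ∀ e ∈ G.edgeSet, φ e < m) (hmk : m < 2 * k) :
    2 * k - 1 ∣ #G.edgeFinset := by
  have hcount := Finset.card_mul_eq_card_mul (s := G.edgeFinset)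
    (t := {f ∈ G.edgeFinset | φ f = 0}) (m := 1) (n := 2 * k - 1)
    (fun e f => ∃ v, v ∈ e ∧ v ∈ f) ?_ ?_
  · exact ⟨_, by rw [mul_one] at hcount; rw [hcount, mul_comm]⟩
  · intro e he
    rw [mem_edgeFinset] at he
    set N : Finset (Sym2 V) := {f ∈ G.edgeFinset | ∃ v, v ∈ e ∧ v ∈ f} with hN
    have hcard : #N = 2 * k - 1 := hreg.card_edges_meeting he
    have hinj : Set.InjOn φ N := by
      intro f hf g hg h
      simp only [hN, coe_filter, mem_edgeFinset, Set.mem_ofPred_eq] at hf hg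
      exact hφ.eq_of_meets he hf.1 hg.1 hf.2 hg.2 h
    have himage : N.image φ = range (2 * k - 1) := by
      apply Finset.eq_of_subset_of_card_le
      · intro c hc
        obtain ⟨f, hf, rfl⟩ := Finset.mem_image.1 hc
        have := hm f (mem_edgeFinset.1 (mem_filter.1 hf).1)
        rw [Finset.mem_range]
        omega
      · rw [Finset.card_image_of_injOn hinj, hcard, card_range]
    obtain ⟨f, hf, hf0⟩ := Finset.mem_image.1
      (himage ▸ Finset.mem_range.2 (by omega) : 0 ∈ N.image φ)
    rw [Finset.card_eq_one]
    refine ⟨f, Finset.ext fun g => ?_⟩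
    rw [mem_bipartiteAbove, mem_filter, mem_singleton]
    constructor
    · rintro ⟨⟨hg, hg0⟩, heg⟩
      exact hinj (mem_filter.2 ⟨hg, heg⟩) hf (hg0.trans hf0.symm)
    · rintro rfl
      exact ⟨⟨(mem_filter.1 hf).1, hf0⟩, (mem_filter.1 hf).2⟩
  · intro f hf
    rw [← hreg.card_edges_meeting (mem_edgeFinset.1 (mem_filter.1 hf).1)]
    simp only [bipartiteBelow, and_comm]

/-- If `k ≥ 2` and `G` is a simple `k`-regular bipartite graph on `2n` vertices, where
`n > 0` is not divisible by `2k-1`, then `χ'ₛ(G) ≥ 2k`. -/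
theorem stmt8 {V : Type*} [Fintype V] (k n : ℕ) (hk : 2 ≤ k) (hn : 0 < n)
    (hcard : Fintype.card V = 2 * n) (hdvd : ¬ (2 * k - 1) ∣ n)
    (G : SimpleGraph V) (hreg : G.IsKRegular k) (hbip : G.Colorable 2) :
    2 * k ≤ G.strongChromaticIndex := by
  classical
  by_contra! hlt
  obtain ⟨φ, hφ, hm⟩ := G.exists_isStrongEdgeColoring_lt_strongChromaticIndex
  have hdvd_edges := hreg.dvd_card_edgeFinset_s8 (by omega) hφ hm hlt
  have hedges : #G.edgeFinset = k * n := by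
    have h := G.sum_degrees_eq_twice_card_edges
    simp only [hreg.isRegularOfDegree.degree_eq, sum_const, card_univ, hcard, smul_eq_mul] at h
    linarith
  have hcop : Nat.Coprime (2 * k - 1) k := by
    rw [show 2 * k - 1 = (k - 1) + k by omega, Nat.coprime_add_self_left]
    obtain ⟨j, rfl⟩ : ∃ j, k = j + 1 := ⟨k - 1, by omega⟩
    simp
  exact hdvd (hcop.dvd_of_dvd_mul_left (hedges ▸ hdvd_edges))
end

section
/- Let g ≥ 3 and let G be a simple graph with girth at least g. Let x_h y_h be an edge of G, and let x_ℓ and y_ℓ be vertices of G such that the distance in G from each of x_ℓ, y_ℓ to each of x_h, y_h is at least g−1 (in particular x_ℓ, y_ℓ ∉ {x_h, y_h}). Then the graph obtained from G by deleting the edge x_h y_h and adding the two edges x_ℓ y_h and y_ℓ x_h has girth at least g. -/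
open SimpleGraph Finset

namespace SimpleGraph

variable {V : Type*} {G : SimpleGraph V} {a b u v : V}

/-- Removing an edge from a closed trail leaves a walk between the endpoints of that edge. -/
lemma Walk.IsTrail.exists_walk_notMem_edges {c : G.Walk u u} (hc : c.IsTrail)
    (he : s(a, b) ∈ c.edges) :
    ∃ q : G.Walk a b, s(a, b) ∉ q.edges ∧ q.length + 1 = c.length := by
  have hadj := c.adj_of_mem_edges he
  rcases (Walk.isSubwalk_toWalk_iff_mem_edges hadj).mpr he with
    ⟨r, s, rfl⟩ | ⟨r, s, rfl⟩
  · refine ⟨(s.append r).reverse, ?_, by simp; omega⟩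
    have := hc.edges_nodup
    simp only [Walk.edges_append, Adj.edges_toWalk] at this
    simp only [Walk.edges_reverse, Walk.edges_append, List.mem_reverse]
    grind
  · refine ⟨s.append r, ?_, by simp; omega⟩
    have := hc.edges_nodup
    simp only [Walk.edges_append, Adj.edges_toWalk, Sym2.eq_swap (a := b)] at this
    simp only [Walk.edges_append]
    grind

/-- A walk in `G ⊔ edge a b` ends with a walk in `G` starting at its initial vertex or at an
endpoint of the added edge. -/
lemma le_length_of_le_edist_sup_edge {n : ℕ∞} (p : (G ⊔ edge a b).Walk u v)
    (hu : n ≤ G.edist u v) (ha : n ≤ G.edist a v) (hb : n ≤ G.edist b v) : n ≤ p.length := by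
  suffices G.edist u v ≤ p.length ∨ G.edist a v ≤ p.length ∨ G.edist b v ≤ p.length by
    rcases this with h | h | h
    exacts [hu.trans h, ha.trans h, hb.trans h]
  clear hu ha hb
  induction p with
  | nil => simp
  | @cons u w v h p ih =>
    have hle : (p.length : ℕ∞) ≤ (p.cons h).length := by simp
    rcases ih with ih | ih | ih
    · rcases h with h' | h'
      · left
        calc G.edist u v ≤ G.edist u w + G.edist w v := SimpleGraph.edist_triangle
          _ ≤ 1 + p.length := add_le_add (edist_eq_one_iff_adj.mpr h').le ih
          _ = _ := by simp [add_comm]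
      · rcases ((edge_adj ..).mp h').1 with ⟨rfl, rfl⟩ | ⟨rfl, rfl⟩
        · exact .inr (.inr (ih.trans hle))
        · exact .inr (.inl (ih.trans hle))
    · exact .inr (.inl (ih.trans hle))
    · exact .inr (.inr (ih.trans hle))

lemma le_edist_sup_edge {n : ℕ∞}
    (hu : n ≤ G.edist u v) (ha : n ≤ G.edist a v) (hb : n ≤ G.edist b v) :
    n ≤ (G ⊔ edge a b).edist u v :=
  le_sInf <| Set.forall_mem_range.mpr fun p ↦ le_length_of_le_edist_sup_edge p hu ha hb

lemma mem_edgeSet_of_mem_edgeSet_sup_edge {e : Sym2 V} (he : e ∈ (G ⊔ edge a b).edgeSet)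
    (hne : e ≠ s(a, b)) : e ∈ G.edgeSet := by
  induction e with | _ x y =>
  rcases he with h | h
  · exact h
  · exact absurd ((adj_edge ..).mp h).1.symm hne

/-- Joining two vertices at distance at least `n` creates no cycle of length at most `n`. -/
lemma le_egirth_sup_edge {n : ℕ∞} (hG : n + 1 ≤ G.egirth) (hab : n ≤ G.edist a b) :
    n + 1 ≤ (G ⊔ edge a b).egirth := by
  rw [le_egirth]
  intro x c hc
  by_cases he : s(a, b) ∈ c.edges
  · obtain ⟨q, hq, hlen⟩ := hc.isTrail.exists_walk_notMem_edges he
    have hq' : ∀ e ∈ q.edges, e ∈ G.edgeSet := fun e h ↦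
      mem_edgeSet_of_mem_edgeSet_sup_edge (q.edges_subset_edgeSet h) (by rintro rfl; exact hq h)
    have := hab.trans (q.transfer G hq').edist_le
    rw [Walk.length_transfer] at this
    rw [← hlen, Nat.cast_add, Nat.cast_one]
    gcongr
  · have hc' : ∀ e ∈ c.edges, e ∈ G.edgeSet := fun e h ↦
      mem_edgeSet_of_mem_edgeSet_sup_edge (c.edges_subset_edgeSet h) (by rintro rfl; exact he h)
    simpa using hG.trans (egirth_le_length (hc.transfer hc'))

/-- After deleting an edge, its endpoints are at distance at least the girth minus one. -/
lemma Adj.egirth_le_edist_deleteEdges_add_one (h : G.Adj a b) :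
    G.egirth ≤ (G.deleteEdges {s(a, b)}).edist a b + 1 := by
  classical
  by_cases ht : (G.deleteEdges {s(a, b)}).edist a b = ⊤
  · simp [ht]
  obtain ⟨p, hp⟩ := exists_walk_of_edist_ne_top ht
  have hmem : s(a, b) ∉ (p.bypass.mapLe (G.deleteEdges_le {s(a, b)})).edges := fun hm ↦ by
    rw [Walk.edges_mapLe_eq_edges] at hm
    simpa using p.bypass.edges_subset_edgeSet hm
  have hcyc := (Walk.cons_isCycle_iff (p.bypass.mapLe (G.deleteEdges_le {s(a, b)})).reverse h).mpr
    ⟨(p.bypass_isPath.mapLe _).reverse, by simpa using hmem⟩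
  refine (egirth_le_length hcyc).trans ?_
  rw [← hp]
  simpa using p.length_bypass_le_length

end SimpleGraph

/-- Let `G` have girth at least `g ≥ 3`, let `xh yh` be an edge, and let `xl`, `yl` be
vertices each at distance at least `g-1` from each of `xh`, `yh`.  Then deleting `xh yh`
and adding the edges `xl yh` and `yl xh` yields a graph of girth at least `g`. -/
theorem stmt11 {V : Type*} (g : ℕ) (hg : 3 ≤ g) (G : SimpleGraph V)
    (hgirth : (g : ℕ∞) ≤ G.egirth) (xh yh xl yl : V) (hadj : G.Adj xh yh)
    (h1 : ((g - 1 : ℕ) : ℕ∞) ≤ G.edist xl xh) (h2 : ((g - 1 : ℕ) : ℕ∞) ≤ G.edist xl yh)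
    (h3 : ((g - 1 : ℕ) : ℕ∞) ≤ G.edist yl xh) (h4 : ((g - 1 : ℕ) : ℕ∞) ≤ G.edist yl yh) :
    (g : ℕ∞) ≤ (G.deleteEdges {s(xh, yh)} ⊔ edge xl yh ⊔ edge yl xh).egirth := by
  have hle := G.deleteEdges_le {s(xh, yh)}
  obtain ⟨n, rfl⟩ : ∃ n, g = n + 1 := ⟨g - 1, by omega⟩
  simp only [Nat.add_sub_cancel, Nat.cast_add, Nat.cast_one] at *
  have hxy : (n : ℕ∞) ≤ (G.deleteEdges {s(xh, yh)}).edist yh xh := by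
    rw [edist_comm]
    exact (ENat.add_le_add_iff_right ENat.one_ne_top).mp
      (hgirth.trans hadj.egirth_le_edist_deleteEdges_add_one)
  exact le_egirth_sup_edge
    (le_egirth_sup_edge (hgirth.trans (egirth_anti hle)) (h2.trans (edist_anti hle)))
    (le_edist_sup_edge (h3.trans (edist_anti hle)) (h1.trans (edist_anti hle)) hxy)
end
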